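/- If m ≥ 4, then every A ∈ K₊ can be written uniquely as A = A₀ + σ₁φ + σ₃ψ where A₀ ∈ K₊ ∩ ker(ρ), φ ∈ S²₊, and ψ ∈ Λ²₊; that is, K₊ is the internal direct sum of the subspaces K₊ ∩ ker(ρ), σ₁(S²₊), and σ₃(Λ²₊). -/

import Mathlib

open Module

variable {V : Type*} [AddCommGroup V] [Module ℝ V]

/-- `A` is an affine curvature operator. -/
def IsAff (A : V →ₗ[ℝ] V →ₗ[ℝ] V →ₗ[ℝ] V) : Prop :=
  (∀ x y, A x y = - A y x) ∧ ∀ x y z, A x y z + A y z x + A z x y = 0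

/-- The Ricci tensor `ρ(A)(x,y) = Tr (z ↦ A(z,x)y)`. -/
noncomputable def rho (A : V →ₗ[ℝ] V →ₗ[ℝ] V →ₗ[ℝ] V) (x y : V) : ℝ :=
  LinearMap.trace ℝ V ((A.flip x).flip y)

/-- `A` is an affine Kähler curvature operator: `A ∈ 𝔄` and `A(x,y)` commutes with `J`. -/
def IsK (J : V →ₗ[ℝ] V) (A : V →ₗ[ℝ] V →ₗ[ℝ] V →ₗ[ℝ] V) : Prop :=
  IsAff A ∧ ∀ x y z, A x y (J z) = J (A x y z)

/-- `A ∈ K₊`. -/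
def IsKplus (J : V →ₗ[ℝ] V) (A : V →ₗ[ℝ] V →ₗ[ℝ] V →ₗ[ℝ] V) : Prop :=
  IsK J A ∧ ∀ x y, A (J x) (J y) = A x y

/-- `A = A₀ + σ₁φ + σ₃ψ` is a decomposition of `A` with `A₀ ∈ K₊ ∩ ker ρ`, `φ ∈ S²₊`
and `ψ ∈ Λ²₊`, where `(σ₁φ)(x,y)z = φ(x,z)y − φ(y,z)x − φ(x,Jz)Jy + φ(y,Jz)Jx − 2φ(x,Jy)Jz`
and `(σ₃ψ)(x,y)z = ψ(x,z)y − ψ(y,z)x + 2ψ(x,y)z − ψ(x,Jz)Jy + ψ(y,Jz)Jx`. -/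
def DecompPlus (J : V →ₗ[ℝ] V) (A A₀ : V →ₗ[ℝ] V →ₗ[ℝ] V →ₗ[ℝ] V)
    (φ ψ : V →ₗ[ℝ] V →ₗ[ℝ] ℝ) : Prop :=
  IsKplus J A₀ ∧ (∀ x y, rho A₀ x y = 0) ∧
  (∀ x y, φ x y = φ y x) ∧ (∀ x y, φ (J x) (J y) = φ x y) ∧
  (∀ x y, ψ x y = - ψ y x) ∧ (∀ x y, ψ (J x) (J y) = ψ x y) ∧
  ∀ x y z, A x y z = A₀ x y z
    + (φ x z • y - φ y z • x - φ x (J z) • J y + φ y (J z) • J x - (2 * φ x (J y)) • J z)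
    + (ψ x z • y - ψ y z • x + (2 * ψ x y) • z - ψ x (J z) • J y + ψ y (J z) • J x)

theorem trace_J_zero [FiniteDimensional ℝ V] (J : V →ₗ[ℝ] V) (hJ : ∀ v, J (J v) = -v) :
    LinearMap.trace ℝ V J = 0 := by
  classical
  let b := Module.finBasis ℝ V
  rw [LinearMap.trace_eq_matrix_trace ℝ b]
  set M := LinearMap.toMatrix b b J with hM
  have hMM : M * M = -1 := by
    have hc : J ∘ₗ J = -LinearMap.id := by ext v; simp [hJ]
    rw [hM, ← LinearMap.toMatrix_comp, hc, map_neg, LinearMap.toMatrix_id]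
  let N := M.map (algebraMap ℝ ℂ)
  have hNN : N * N = -1 := by
    have h := congrArg (fun X => (algebraMap ℝ ℂ).mapMatrix X) hMM
    simp only [map_mul, map_neg, map_one] at h
    exact h
  have hroot : ∀ μ ∈ N.charpoly.roots, μ.re = 0 := by
    intro μ hμ
    have h1 : N.charpoly.IsRoot μ := Polynomial.isRoot_of_mem_roots hμ
    rw [Polynomial.IsRoot, Matrix.eval_charpoly] at h1
    obtain ⟨v, hv, hv2⟩ := Matrix.exists_mulVec_eq_zero_iff.mpr h1
    have h3 : N.mulVec v = μ • v := by
      rw [Matrix.sub_mulVec, sub_eq_zero] at hv2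
      rw [← hv2]; ext i; simp [Matrix.scalar_apply, Matrix.mulVec_diagonal]
    have h4 : (μ * μ + 1) • v = 0 := by
      have : (N * N).mulVec v = (μ * μ) • v := by
        rw [← Matrix.mulVec_mulVec, h3, Matrix.mulVec_smul, h3, smul_smul]
      rw [hNN, Matrix.neg_mulVec, Matrix.one_mulVec] at this
      rw [add_smul, ← this]; simp
    have h5 : μ * μ + 1 = 0 := (smul_eq_zero.mp h4).resolve_right hv
    have hr := congrArg Complex.re h5
    have hi := congrArg Complex.im h5
    simp at hr hi
    have : μ.re * μ.im = 0 := by linarith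
    rcases mul_eq_zero.mp this with h | h
    · exact h
    · rw [h] at hr; nlinarith
  have ht : N.trace = ((M.trace : ℝ) : ℂ) := by
    simp [N, Matrix.trace]
  have hs : N.trace = N.charpoly.roots.sum := Matrix.trace_eq_sum_roots_charpoly N
  have h6 : N.trace.re = 0 := by
    rw [hs]
    have : (N.charpoly.roots.sum).re = (N.charpoly.roots.map Complex.re).sum :=
      map_multiset_sum Complex.reAddGroupHom _
    rw [this, Multiset.sum_eq_zero]
    intro x hx
    obtain ⟨μ, hμ, rfl⟩ := Multiset.mem_map.mp hx
    exact hroot μ hμ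
  rw [ht] at h6
  simpa using h6

/-- the sum of the two `σ` maps, linear in the last argument -/
noncomputable def sigZ (J : V →ₗ[ℝ] V) (φ ψ : V →ₗ[ℝ] V →ₗ[ℝ] ℝ) (x y : V) : V →ₗ[ℝ] V :=
  ((φ x).smulRight y - (φ y).smulRight x - ((φ x).comp J).smulRight (J y)
    + ((φ y).comp J).smulRight (J x) - (2 * φ x (J y)) • J)
  + ((ψ x).smulRight y - (ψ y).smulRight x + (2 * ψ x y) • LinearMap.id
    - ((ψ x).comp J).smulRight (J y) + ((ψ y).comp J).smulRight (J x))

noncomputable def sig (J : V →ₗ[ℝ] V) (φ ψ : V →ₗ[ℝ] V →ₗ[ℝ] ℝ) :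
    V →ₗ[ℝ] V →ₗ[ℝ] V →ₗ[ℝ] V :=
  LinearMap.mk₂ ℝ (sigZ J φ ψ)
    (by intros; ext z; simp [sigZ]; module)
    (by intros; ext z; simp [sigZ]; module)
    (by intros; ext z; simp [sigZ]; module)
    (by intros; ext z; simp [sigZ]; module)

theorem sig_apply (J : V →ₗ[ℝ] V) (φ ψ : V →ₗ[ℝ] V →ₗ[ℝ] ℝ) (x y z : V) :
    sig J φ ψ x y z =
    (φ x z • y - φ y z • x - φ x (J z) • J y + φ y (J z) • J x - (2 * φ x (J y)) • J z)
    + (ψ x z • y - ψ y z • x + (2 * ψ x y) • z - ψ x (J z) • J y + ψ y (J z) • J x) := by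
  simp [sig, sigZ]

theorem J_flip (J : V →ₗ[ℝ] V) (hJ : ∀ v, J (J v) = -v) (φ : V →ₗ[ℝ] V →ₗ[ℝ] ℝ)
    (h : ∀ x y, φ (J x) (J y) = φ x y) (x y : V) : φ (J x) y = - φ x (J y) := by
  have := h x (J y)
  rw [hJ] at this
  simp at this
  linarith

theorem sig_Kplus (J : V →ₗ[ℝ] V) (hJ : ∀ v, J (J v) = -v) (φ ψ : V →ₗ[ℝ] V →ₗ[ℝ] ℝ)
    (h1 : ∀ x y, φ x y = φ y x) (h2 : ∀ x y, φ (J x) (J y) = φ x y)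
    (h3 : ∀ x y, ψ x y = - ψ y x) (h4 : ∀ x y, ψ (J x) (J y) = ψ x y) :
    IsKplus J (sig J φ ψ) := by
  have f1 := J_flip J hJ φ h2
  have f2 := J_flip J hJ ψ h4
  have g1 : ∀ x y, φ x (J y) = - φ y (J x) := fun x y => by rw [← f1 y x, h1]; 
  have g2 : ∀ x y, ψ x (J y) = ψ y (J x) := fun x y => by rw [h3, f2]; simp
  refine ⟨⟨⟨fun x y => ?_, fun x y z => ?_⟩, fun x y z => ?_⟩, fun x y => ?_⟩
  · ext z
    simp only [LinearMap.neg_apply, sig_apply]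
    rw [g1 y x, h3 y x]
    module
  · simp only [sig_apply]
    rw [g1 y x, g1 z y, g1 z x, h3 y x, h3 z y, h3 z x, g2 y x, g2 z y, g2 z x,
      h1 y x, h1 z y, h1 z x]
    module
  · simp only [sig_apply, hJ, map_add, map_sub, map_smul, map_neg]
    module
  · ext z
    simp only [sig_apply, hJ, h2, h4, f1, f2, map_neg]
    module

theorem rho_sig [FiniteDimensional ℝ V] (J : V →ₗ[ℝ] V) (hJ : ∀ v, J (J v) = -v)
    (φ ψ : V →ₗ[ℝ] V →ₗ[ℝ] ℝ)
    (h1 : ∀ x y, φ x y = φ y x) (h2 : ∀ x y, φ (J x) (J y) = φ x y)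
    (h3 : ∀ x y, ψ x y = - ψ y x) (h4 : ∀ x y, ψ (J x) (J y) = ψ x y) (x y : V) :
    rho (sig J φ ψ) x y = -((finrank ℝ V : ℝ) + 2) * (φ x y + ψ x y) := by
  have e : ((sig J φ ψ).flip x).flip y =
      ((φ.flip y).smulRight x - (φ x y) • LinearMap.id - (φ.flip (J y)).smulRight (J x)
        + (φ x (J y)) • J - (2 : ℝ) • (φ.flip (J x)).smulRight (J y))
      + ((ψ.flip y).smulRight x - (ψ x y) • LinearMap.id + (2 : ℝ) • (ψ.flip x).smulRight y
        - (ψ.flip (J y)).smulRight (J x) + (ψ x (J y)) • J) := by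
    ext z
    simp [sig_apply]
    module
  rw [rho, e]
  simp only [map_add, map_sub, map_smul, LinearMap.trace_smulRight, LinearMap.trace_id,
    trace_J_zero J hJ, LinearMap.flip_apply, h2, h4, smul_eq_mul]
  rw [h1 y x, h3 y x]
  ring

theorem rho_sub (A B : V →ₗ[ℝ] V →ₗ[ℝ] V →ₗ[ℝ] V) (x y : V) :
    rho (A - B) x y = rho A x y - rho B x y := by
  simp only [rho, ← map_sub]
  congr 1

theorem rho_add (A B : V →ₗ[ℝ] V →ₗ[ℝ] V →ₗ[ℝ] V) (x y : V) :
    rho (A + B) x y = rho A x y + rho B x y := by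
  simp only [rho, ← map_add]
  congr 1

noncomputable def rhoL (A : V →ₗ[ℝ] V →ₗ[ℝ] V →ₗ[ℝ] V) : V →ₗ[ℝ] V →ₗ[ℝ] ℝ :=
  LinearMap.mk₂ ℝ (rho A)
    (by intros; simp only [rho, ← map_add]; congr 1; ext; simp)
    (by intros; simp only [rho, ← map_smul]; congr 1; ext; simp)
    (by intros; simp only [rho, ← map_add])
    (by intros; simp only [rho, ← map_smul])

theorem rhoL_apply (A : V →ₗ[ℝ] V →ₗ[ℝ] V →ₗ[ℝ] V) (x y : V) : rhoL A x y = rho A x y := rfl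

theorem rho_J (J : V →ₗ[ℝ] V) (hJ : ∀ v, J (J v) = -v)
    (A : V →ₗ[ℝ] V →ₗ[ℝ] V →ₗ[ℝ] V) (hA : IsKplus J A) (x y : V) :
    rho A (J x) (J y) = rho A x y := by
  obtain ⟨⟨-, hK⟩, hp⟩ := hA
  have e : (A.flip (J x)).flip (J y) = -(J * (((A.flip x).flip y) * J)) := by
    ext z
    have := hp z (J x)
    rw [hJ] at this
    simp [hK, ← this]
  have e2 : J * J = -1 := by ext z; simp [hJ]
  rw [rho, e, map_neg, LinearMap.trace_mul_comm, mul_assoc, e2, rho]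
  simp

theorem IsKplus.sub {J : V →ₗ[ℝ] V} {A B : V →ₗ[ℝ] V →ₗ[ℝ] V →ₗ[ℝ] V}
    (hA : IsKplus J A) (hB : IsKplus J B) : IsKplus J (A - B) := by
  obtain ⟨⟨⟨a1, a2⟩, a3⟩, a4⟩ := hA
  obtain ⟨⟨⟨b1, b2⟩, b3⟩, b4⟩ := hB
  refine ⟨⟨⟨fun x y => ?_, fun x y z => ?_⟩, fun x y z => ?_⟩, fun x y => ?_⟩
  · simp only [LinearMap.sub_apply]; rw [a1, b1]; abel
  · have := congrArg₂ (· - ·) (a2 x y z) (b2 x y z)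
    simp only [sub_zero] at this
    simp only [LinearMap.sub_apply]; rw [← this]; abel
  · simp [a3, b3]
  · simp [a4, b4]

theorem decomp_iff [FiniteDimensional ℝ V] (J : V →ₗ[ℝ] V) (hJ : ∀ v, J (J v) = -v)
    (A A₀ : V →ₗ[ℝ] V →ₗ[ℝ] V →ₗ[ℝ] V) (φ ψ : V →ₗ[ℝ] V →ₗ[ℝ] ℝ)
    (h : DecompPlus J A A₀ φ ψ) :
    A = A₀ + sig J φ ψ ∧ (∀ x y, φ x y + ψ x y = -(rho A x y) / ((finrank ℝ V : ℝ) + 2)) := by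
  obtain ⟨-, h0, h1, h2, h3, h4, h5⟩ := h
  have e : A = A₀ + sig J φ ψ := by
    ext x y z
    rw [h5]; simp only [LinearMap.add_apply, sig_apply]; abel
  refine ⟨e, fun x y => ?_⟩
  have hn : (finrank ℝ V : ℝ) + 2 ≠ 0 := by positivity
  rw [e, rho_add, h0, rho_sig J hJ φ ψ h1 h2 h3 h4]
  field_simp
  ring

/-- if `m ≥ 4`, every `A ∈ K₊` decomposes uniquely as
`A = A₀ + σ₁φ + σ₃ψ` with `A₀ ∈ K₊ ∩ ker ρ`, `φ ∈ S²₊`, `ψ ∈ Λ²₊`. -/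
theorem statement4 [FiniteDimensional ℝ V] (J : V →ₗ[ℝ] V) (hJ : ∀ v, J (J v) = -v)
    (hm : 4 ≤ finrank ℝ V) :
    ∀ A : V →ₗ[ℝ] V →ₗ[ℝ] V →ₗ[ℝ] V, IsKplus J A →
      (∃ A₀ : V →ₗ[ℝ] V →ₗ[ℝ] V →ₗ[ℝ] V, ∃ φ ψ : V →ₗ[ℝ] V →ₗ[ℝ] ℝ,
        DecompPlus J A A₀ φ ψ) ∧
      (∀ A₀ A₀' : V →ₗ[ℝ] V →ₗ[ℝ] V →ₗ[ℝ] V, ∀ φ ψ φ' ψ' : V →ₗ[ℝ] V →ₗ[ℝ] ℝ,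
        DecompPlus J A A₀ φ ψ → DecompPlus J A A₀' φ' ψ' →
        A₀ = A₀' ∧ φ = φ' ∧ ψ = ψ') := by
  intro A hA
  have hn : (finrank ℝ V : ℝ) + 2 ≠ 0 := by positivity
  constructor
  · let c : ℝ := -1 / (2 * ((finrank ℝ V : ℝ) + 2))
    let φ : V →ₗ[ℝ] V →ₗ[ℝ] ℝ := c • (rhoL A + (rhoL A).flip)
    let ψ : V →ₗ[ℝ] V →ₗ[ℝ] ℝ := c • (rhoL A - (rhoL A).flip)
    have hφ : ∀ x y, φ x y = c * (rho A x y + rho A y x) := fun x y => by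
      simp only [φ, LinearMap.smul_apply, LinearMap.add_apply, LinearMap.flip_apply, rhoL_apply,
        smul_eq_mul]
    have hψ : ∀ x y, ψ x y = c * (rho A x y - rho A y x) := fun x y => by
      simp only [ψ, LinearMap.smul_apply, LinearMap.sub_apply, LinearMap.flip_apply, rhoL_apply,
        smul_eq_mul]
    have h1 : ∀ x y, φ x y = φ y x := fun x y => by rw [hφ, hφ]; ring
    have h3 : ∀ x y, ψ x y = - ψ y x := fun x y => by rw [hψ, hψ]; ring
    have h2 : ∀ x y, φ (J x) (J y) = φ x y := fun x y => by
      rw [hφ, hφ, rho_J J hJ A hA, rho_J J hJ A hA]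
    have h4 : ∀ x y, ψ (J x) (J y) = ψ x y := fun x y => by
      rw [hψ, hψ, rho_J J hJ A hA, rho_J J hJ A hA]
    refine ⟨A - sig J φ ψ, φ, ψ, hA.sub (sig_Kplus J hJ φ ψ h1 h2 h3 h4), fun x y => ?_,
      h1, h2, h3, h4, fun x y z => ?_⟩
    · rw [rho_sub, rho_sig J hJ φ ψ h1 h2 h3 h4, hφ, hψ]
      simp only [c]
      field_simp
      ring
    · simp only [LinearMap.sub_apply, sig_apply]
      abel
  · intro A₀ A₀' φ ψ φ' ψ' h h'
    obtain ⟨e, hr⟩ := decomp_iff J hJ _ _ _ _ h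
    obtain ⟨e', hr'⟩ := decomp_iff J hJ _ _ _ _ h'
    obtain ⟨-, -, h1, -, h3, -, -⟩ := h
    obtain ⟨-, -, h1', -, h3', -, -⟩ := h'
    have hφ : φ = φ' := by
      ext x y
      linarith [hr x y, hr y x, hr' x y, hr' y x, h1 x y, h3 x y, h1' x y, h3' x y]
    have hψ : ψ = ψ' := by
      ext x y
      linarith [hr x y, hr y x, hr' x y, hr' y x, h1 x y, h3 x y, h1' x y, h3' x y]
    subst hφ hψ
    refine ⟨?_, rfl, rfl⟩
    ext x y z
    have h6 := congrArg (fun B => B x y z) (e.symm.trans e')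
    simp only [LinearMap.add_apply] at h6
    exact add_right_cancel h6
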